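/- arXiv:2011.03126 — 2 statements merged into one kernel-verified Lean document; each statement's English description precedes it below -/
import Mathlib

section
/- Fix k ∈ ℕ. Then W_k(ℝ) ⊆ NC^k(ℝ) and C^{k+1}(ℝ) ⊆ NC^k(ℝ); moreover the closure of W_k(ℝ) and the closure of C^{k+1}(ℝ) in 𝒞^{[k]}(ℝ) with respect to the family of seminorms ‖·‖_{𝒞^{[k]},r} (r > 0) both equal NC^k(ℝ), i.e., for every f ∈ W_k(ℝ) (respectively f ∈ C^{k+1}(ℝ)) there is a sequence of polynomials (q_n) with ‖f − q_n‖_{𝒞^{[k]},r} → 0 for every r > 0. -/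
open MeasureTheory Filter
open scoped ENNReal NNReal

/-- The continuous extension of the `k`-th divided difference of a `C^k` function, given by
integration of the `k`-th derivative over the standard simplex (Proposition 2.3(ii)). -/
noncomputable def divDiffC (f : ℝ → ℂ) (k : ℕ) (lam : Fin (k + 1) → ℝ) : ℂ :=
  ∫ s in {s : Fin k → ℝ | (∀ i, 0 ≤ s i) ∧ ∑ i, s i ≤ 1},
    iteratedDeriv k f
      ((∑ i : Fin k, s i * lam i.castSucc) + (1 - ∑ i : Fin k, s i) * lam (Fin.last k))

/-- The `ℓ^∞`-integral projective tensor norm of a function `φ : Ω_1 × ⋯ × Ω_m → ℂ`: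
the infimum, over all `ℓ^∞`-integral projective decompositions
`(Σ, ρ, φ_1, …, φ_m)` of `φ` (with `ρ` a σ-finite measure, the `φ_j` product-measurable and
bounded in the first variable, and `φ(ω) = ∫_Σ ∏_j φ_j(ω_j, σ) ρ(dσ)`), of
`∫_Σ ∏_j sup_{ω_j} |φ_j(ω_j, σ)| ρ(dσ)`; it is `∞` if no decomposition exists. -/
noncomputable def iptNorm {m : ℕ} {Ω : Fin m → Type*} [∀ i, MeasurableSpace (Ω i)]
    (φ : (∀ i, Ω i) → ℂ) : ℝ≥0∞ :=
  sInf {c : ℝ≥0∞ |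
    ∃ (S : Type) (_ : MeasurableSpace S) (ρ : MeasureTheory.Measure S)
      (φs : ∀ i, Ω i × S → ℂ),
      MeasureTheory.SigmaFinite ρ ∧ (∀ i, Measurable (φs i)) ∧
      (∀ i σ, ∃ C : ℝ, ∀ ω, ‖φs i (ω, σ)‖ ≤ C) ∧
      (∫⁻ σ, ∏ i, ⨆ ω, (‖φs i (ω, σ)‖₊ : ℝ≥0∞) ∂ρ) ≠ ∞ ∧
      (∀ ω : ∀ i, Ω i, φ ω = ∫ σ, ∏ i, φs i (ω i, σ) ∂ρ) ∧
      c = ∫⁻ σ, ∏ i, ⨆ ω, (‖φs i (ω, σ)‖₊ : ℝ≥0∞) ∂ρ}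

/-- `‖φ‖_{r,m}` : the `ℓ^∞`-integral projective tensor norm of `φ` restricted to `[-r,r]^m`. -/
noncomputable def iptNormIcc (r : ℝ) {m : ℕ} (φ : (Fin m → ℝ) → ℂ) : ℝ≥0∞ :=
  iptNorm (Ω := fun _ : Fin m => (Set.Icc (-r) r : Set ℝ)) fun ω => φ fun i => (ω i : ℝ)

/-- `‖f‖_{𝒞^{[k]},r} = ∑_{j=0}^k ‖f^{[j]}‖_{r,j+1}`. -/
noncomputable def cNorm (k : ℕ) (r : ℝ) (f : ℝ → ℂ) : ℝ≥0∞ :=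
  ∑ j ∈ Finset.range (k + 1), iptNormIcc r (divDiffC f j)

/-- Membership in the Wiener space `W_k(ℝ)` : `f(λ) = ∫_ℝ e^{iλξ} μ(dξ)` for a Borel complex
measure `μ` with `∫ |ξ|^k d|μ| < ∞`.  The complex measure `μ` is encoded in polar form
`μ(dξ) = h(ξ) ν(dξ)` with `ν = |μ|` a finite (positive) Borel measure and `|h| ≡ 1`. -/
def memWiener (k : ℕ) (f : ℝ → ℂ) : Prop :=
  ∃ (ν : MeasureTheory.Measure ℝ) (h : ℝ → ℂ),
    MeasureTheory.IsFiniteMeasure ν ∧ Measurable h ∧ (∀ ξ, ‖h ξ‖ = 1) ∧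
    (∫⁻ ξ, (‖ξ‖₊ : ℝ≥0∞) ^ k ∂ν) ≠ ∞ ∧
    ∀ lam : ℝ, f lam = ∫ ξ, Complex.exp (Complex.I * lam * ξ) * h ξ ∂ν

/-- `h` is on `[-r,r]` an absolutely convergent superposition of exponentials of mass `≤ C`. -/
def ExpRep (r : ℝ) (h : ℝ → ℂ) (C : ℝ≥0∞) : Prop :=
  ∃ (S : Type) (_ : MeasurableSpace S) (ν : Measure S) (ξ : S → ℝ) (c : S → ℂ),
    SigmaFinite ν ∧ Measurable ξ ∧ Measurable c ∧ (∫⁻ σ, ‖c σ‖ₑ ∂ν) ≤ C ∧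
    ∀ x ∈ Set.Icc (-r) r, h x = ∫ σ, c σ * Complex.exp (((x * ξ σ : ℝ) : ℂ) * Complex.I) ∂ν

lemma ExpRep.mono {r : ℝ} {h : ℝ → ℂ} {C D : ℝ≥0∞} (H : ExpRep r h C) (hCD : C ≤ D) : ExpRep r h D := by
  obtain ⟨S, mS, ν, ξ, c, h1, h2, h3, h4, h5⟩ := H
  exact ⟨S, mS, ν, ξ, c, h1, h2, h3, h4.trans hCD, h5⟩

lemma integrable_mul_exp {S : Type*} [MeasurableSpace S] {ν : Measure S} {ξ : S → ℝ} {c : S → ℂ}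
    (h2 : Measurable ξ) (h3 : Measurable c) (h4 : (∫⁻ σ, ‖c σ‖ₑ ∂ν) ≠ ∞) :
    Integrable (fun σ => c σ * Complex.exp ((ξ σ : ℂ) * Complex.I)) ν := by
  have hc : Integrable c ν := ⟨h3.aestronglyMeasurable, lt_top_iff_ne_top.2 h4⟩
  refine hc.mono (by fun_prop) (Eventually.of_forall fun σ => ?_)
  rw [norm_mul, Complex.norm_exp_ofReal_mul_I, mul_one]

lemma ExpRep.add {r : ℝ} {h g : ℝ → ℂ} {C D : ℝ≥0∞} (hC : C ≠ ∞) (hD : D ≠ ∞)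
    (H : ExpRep r h C) (G : ExpRep r g D) : ExpRep r (fun x => h x + g x) (C + D) := by
  obtain ⟨S, mS, ν, ξ, c, h1, h2, h3, h4, h5⟩ := H
  obtain ⟨S', mS', ν', ξ', c', h1', h2', h3', h4', h5'⟩ := G
  have e1 : MeasurableEmbedding (Sum.inl : S → S ⊕ S') :=
    ⟨Sum.inl_injective, measurable_inl, fun _ hs => hs.inl_image⟩
  have e2 : MeasurableEmbedding (Sum.inr : S' → S ⊕ S') :=
    ⟨Sum.inr_injective, measurable_inr, fun _ hs => hs.inr_image⟩
  have s1 : SigmaFinite (ν.map (Sum.inl : S → S ⊕ S')) := e1.sigmaFinite_map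
  have s2 : SigmaFinite (ν'.map (Sum.inr : S' → S ⊕ S')) := e2.sigmaFinite_map
  have mξ : Measurable (Sum.elim ξ ξ') := h2.sumElim h2'
  have mc : Measurable (Sum.elim c c') := h3.sumElim h3'
  refine ⟨S ⊕ S', inferInstance, ν.map Sum.inl + ν'.map Sum.inr, Sum.elim ξ ξ', Sum.elim c c',
    inferInstance, mξ, mc, ?_, fun x hx => ?_⟩
  · rw [lintegral_add_measure, e1.lintegral_map, e2.lintegral_map]
    exact add_le_add h4 h4'
  · beta_reduce
    rw [integral_add_measure, e1.integral_map, e2.integral_map, h5 x hx, h5' x hx]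
    · rfl
    · rw [e1.integrable_map_iff]
      exact integrable_mul_exp (by fun_prop) h3 (ne_top_of_le_ne_top hC h4)
    · rw [e2.integrable_map_iff]
      exact integrable_mul_exp (by fun_prop) h3' (ne_top_of_le_ne_top hD h4')

/-- The simplex. -/
def simp0 (j : ℕ) : Set (Fin j → ℝ) := {s : Fin j → ℝ | (∀ i, 0 ≤ s i) ∧ ∑ i, s i ≤ 1}

lemma simp0_meas (j : ℕ) : MeasurableSet (simp0 j) := by
  have : simp0 j = (⋂ i, {s : Fin j → ℝ | 0 ≤ s i}) ∩ {s | ∑ i, s i ≤ 1} := by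
    ext s; simp [simp0]
  rw [this]
  refine (MeasurableSet.iInter fun i => ?_).inter ?_
  · exact measurableSet_le (by fun_prop) (by fun_prop)
  · exact measurableSet_le (by fun_prop) (by fun_prop)

lemma simp0_vol (j : ℕ) : volume (simp0 j) ≤ 1 := by
  calc volume (simp0 j) ≤ volume (Set.Icc (0 : Fin j → ℝ) 1) := by
        apply measure_mono
        rintro s ⟨h1, h2⟩
        refine ⟨h1, fun i => le_trans ?_ h2⟩
        exact Finset.single_le_sum (fun i _ => h1 i) (Finset.mem_univ i)
    _ = 1 := by simp [Real.volume_Icc_pi]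

/-- barycentric weights -/
def wts {j : ℕ} (s : Fin j → ℝ) (i : Fin (j + 1)) : ℝ :=
  Fin.snoc (α := fun _ => ℝ) s (1 - ∑ i, s i) i

lemma wts_meas {j : ℕ} (i : Fin (j + 1)) : Measurable (fun s : Fin j → ℝ => wts s i) := by
  refine Fin.lastCases ?_ (fun i => ?_) i
  · simp only [wts, Fin.snoc_last]; fun_prop
  · simp only [wts, Fin.snoc_castSucc]; fun_prop

lemma wts_mem {j : ℕ} {s : Fin j → ℝ} (hs : s ∈ simp0 j) {r : ℝ} {l : Fin (j + 1) → ℝ}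
    (hl : ∀ i, l i ∈ Set.Icc (-r) r) : ∑ i, wts s i * l i ∈ Set.Icc (-r) r := by
  have h0 : ∀ i, 0 ≤ wts s i := by
    intro i
    refine Fin.lastCases ?_ (fun i => ?_) i
    · simpa [wts, Fin.snoc_last] using hs.2
    · simpa [wts, Fin.snoc_castSucc] using hs.1 i
  have h1 : ∑ i, wts s i = 1 := by
    rw [Fin.sum_univ_castSucc]; simp [wts]
  exact (convex_Icc (-r) r).sum_mem (fun i _ => h0 i) h1 (fun i _ => hl i)

lemma iptNormIcc_le {r : ℝ} {j : ℕ} {f : ℝ → ℂ} {C : ℝ≥0∞} (hC : C ≠ ∞)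
    (H : ExpRep r (iteratedDeriv j f) C) : iptNormIcc r (divDiffC f j) ≤ C := by
  obtain ⟨S, mS, ν, ξ, c, h1, h2, h3, h4, h5⟩ := H
  let μ : Measure (Fin j → ℝ) := volume.restrict (simp0 j)
  have hμ : μ Set.univ ≤ 1 := by simpa [μ] using simp0_vol j
  have : IsFiniteMeasure μ := ⟨lt_of_le_of_lt hμ (by simp)⟩
  let φs : Fin (j + 1) → (Set.Icc (-r) r : Set ℝ) × (S × (Fin j → ℝ)) → ℂ := fun i p =>
    (if i = Fin.last j then c p.2.1 else 1) *
      Complex.exp (((wts p.2.2 i * (p.1 : ℝ) * ξ p.2.1 : ℝ) : ℂ) * Complex.I)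
  have hn : ∀ i p, ‖φs i p‖ = ‖(if i = Fin.last j then c p.2.1 else 1 : ℂ)‖ := by
    intro i p
    simp only [φs]
    rw [norm_mul, Complex.norm_exp_ofReal_mul_I, mul_one]
  have hle : ∫⁻ σ, ∏ i, ⨆ ω, (‖φs i (ω, σ)‖₊ : ℝ≥0∞) ∂(ν.prod μ) ≤ C := by
    calc ∫⁻ σ, ∏ i, ⨆ ω, (‖φs i (ω, σ)‖₊ : ℝ≥0∞) ∂(ν.prod μ)
        ≤ ∫⁻ σ, ‖c σ.1‖ₑ ∂(ν.prod μ) := by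
          apply lintegral_mono
          intro σ
          calc ∏ i, ⨆ ω, (‖φs i (ω, σ)‖₊ : ℝ≥0∞)
              ≤ ∏ i, (‖(if i = Fin.last j then c σ.1 else 1 : ℂ)‖ₑ) := by
                apply Finset.prod_le_prod'
                intro i _
                refine iSup_le fun ω => ?_
                rw [← enorm_eq_nnnorm, ← ofReal_norm, ← ofReal_norm, hn]
            _ = ‖c σ.1‖ₑ := by
                rw [Fin.prod_univ_castSucc]
                simp [Fin.castSucc_ne_last]
      _ = (∫⁻ σ, ‖c σ‖ₑ ∂ν) * μ Set.univ := by
          rw [lintegral_prod _ (by fun_prop)]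
          simp [lintegral_mul_const _ h3.enorm]
      _ ≤ C := by
          calc _ ≤ C * 1 := mul_le_mul' h4 hμ
            _ = C := mul_one _
  refine le_trans (sInf_le ⟨S × (Fin j → ℝ), inferInstance, ν.prod μ, φs, inferInstance,
    fun i => ?_, fun i σ => ?_, ne_top_of_le_ne_top hC hle, fun ω => ?_, rfl⟩) hle
  · have m1 : Measurable fun p : (Set.Icc (-r) r : Set ℝ) × (S × (Fin j → ℝ)) => wts p.2.2 i :=
      (wts_meas i).comp (by fun_prop)
    simp only [φs]
    by_cases hi : i = Fin.last j <;> simp only [hi, if_true, if_false] at m1 ⊢ <;> fun_prop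
  · exact ⟨‖(if i = Fin.last j then c σ.1 else 1 : ℂ)‖, fun ω => (hn i (ω, σ)).le⟩
  · have hprod : ∀ p : S × (Fin j → ℝ), ∏ i, φs i (ω i, p) =
        c p.1 * Complex.exp ((((∑ i, wts p.2 i * (ω i : ℝ)) * ξ p.1 : ℝ) : ℂ) * Complex.I) := by
      intro p
      simp only [φs]
      rw [Finset.prod_mul_distrib, ← Complex.exp_sum, Fin.prod_univ_castSucc]
      simp only [Fin.castSucc_ne_last, if_false, if_true, Finset.prod_const_one, one_mul]
      congr 2
      rw [← Finset.sum_mul, ← Complex.ofReal_sum, Finset.sum_mul]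
    simp only [hprod]
    have m1 : Measurable fun p : S × (Fin j → ℝ) => (∑ i, wts p.2 i * (ω i : ℝ)) * ξ p.1 := by
      refine Measurable.mul (Finset.measurable_sum _ fun i _ => ?_) (by fun_prop)
      exact ((wts_meas i).comp measurable_snd).mul_const _
    have hint : Integrable (fun p : S × (Fin j → ℝ) => c p.1 *
        Complex.exp ((((∑ i, wts p.2 i * (ω i : ℝ)) * ξ p.1 : ℝ) : ℂ) * Complex.I))
        (ν.prod μ) := by
      refine integrable_mul_exp (c := fun p : S × (Fin j → ℝ) => c p.1) m1 (by fun_prop) ?_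
      rw [lintegral_prod _ (by fun_prop)]
      simp only [lintegral_const]
      rw [lintegral_mul_const _ h3.enorm]
      exact ENNReal.mul_ne_top (ne_top_of_le_ne_top hC h4) (measure_ne_top _ _)
    rw [integral_prod_symm _ hint]
    unfold divDiffC
    refine setIntegral_congr_fun (simp0_meas j) fun s hs => ?_
    have hm := wts_mem hs (fun i => (ω i).2)
    simp only
    rw [← h5 _ hm, Fin.sum_univ_castSucc]
    simp [wts]

lemma expRep_of_C1 (r : ℝ) (hr : 0 < r) : ∃ C : ℝ, 0 ≤ C ∧ ∀ h h' : ℝ → ℂ,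
    (∀ x, HasDerivAt h (h' x) x) → Continuous h' → ∀ δ : ℝ, 0 < δ →
    (∀ x ∈ Set.Icc (-(2 * r)) (2 * r), ‖h x‖ ≤ δ ∧ ‖h' x‖ ≤ δ) →
    ExpRep r h (ENNReal.ofReal (C * δ)) := by
  let χ : ContDiffBump (0 : ℝ) := ⟨r, 2 * r, hr, by linarith⟩
  have hχs : ContDiff ℝ 1 χ := χ.contDiff
  have hχd : Continuous (deriv χ) := hχs.continuous_deriv le_rfl
  obtain ⟨M, hM⟩ := (isCompact_Icc (a := -(2 * r)) (b := 2 * r)).exists_bound_of_continuousOn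
    hχd.continuousOn
  have hM0 : 0 ≤ M := (norm_nonneg _).trans (hM 0 ⟨by linarith, by linarith⟩)
  let T : ℝ := 4 * r
  have hT : 0 < T := by simp only [T]; linarith
  have fT : Fact (0 < T) := ⟨hT⟩
  let Z : ℝ := ∑' n : ℤ, 1 / (n : ℝ) ^ 2
  have hZ : HasSum (fun n : ℤ => 1 / (n : ℝ) ^ 2) Z :=
    (Real.summable_one_div_int_pow.2 one_lt_two).hasSum
  have hZ0 : 0 ≤ Z := tsum_nonneg fun n => by positivity
  refine ⟨1 + T * ((M + 1) * Z + (M + 1)), by positivity, fun h h' hd hc δ hδ hb => ?_⟩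
  have hhc : Continuous h := continuous_iff_continuousAt.2 fun x => (hd x).continuousAt
  let g : ℝ → ℂ := fun x => (χ x : ℂ) * h x
  let g' : ℝ → ℂ := fun x => ((deriv χ x : ℝ) : ℂ) * h x + (χ x : ℂ) * h' x
  have hg : ∀ x, HasDerivAt g (g' x) x := fun x =>
    (((hχs.differentiable one_ne_zero) x).hasDerivAt.ofReal_comp).mul (hd x)
  have hχc : Continuous χ := hχs.continuous
  have hgc : Continuous g := by simp only [g]; fun_prop
  have hgc' : Continuous g' := by simp only [g']; fun_prop
  let D : ℝ := (M + 1) * δ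
  have hD : 0 < D := by positivity
  have hχ1 : ∀ x, ‖(χ x : ℂ)‖ ≤ 1 := fun x => by
    rw [Complex.norm_real, Real.norm_of_nonneg χ.nonneg]; exact χ.le_one
  have hgb : ∀ x ∈ Set.Icc (-(2 * r)) (2 * r), ‖g x‖ ≤ δ := fun x hx => by
    simp only [g, norm_mul]
    calc _ ≤ 1 * δ := mul_le_mul (hχ1 x) (hb x hx).1 (norm_nonneg _) zero_le_one
      _ = δ := one_mul _
  have hgb' : ∀ x ∈ Set.Icc (-(2 * r)) (2 * r), ‖g' x‖ ≤ D := fun x hx => by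
    simp only [g', D]
    refine (norm_add_le _ _).trans ?_
    rw [norm_mul, norm_mul, Complex.norm_real, add_mul]
    exact add_le_add (mul_le_mul (hM x hx) (hb x hx).1 (norm_nonneg _) hM0)
      (mul_le_mul (hχ1 x) (hb x hx).2 (norm_nonneg _) zero_le_one)
  let a : ℝ := -(2 * r)
  have haT : a + T = 2 * r := by simp only [a, T]; ring
  have ha : a < a + T := lt_add_of_pos_right a hT
  have hga : g a = 0 := by
    simp only [g]
    rw [χ.zero_of_le_dist (by simp [a, χ, abs_of_pos hr])]; simp
  have hgb0 : g (a + T) = 0 := by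
    simp only [g]
    rw [χ.zero_of_le_dist (by rw [haT]; simp [χ, abs_of_pos hr])]; simp
  let A : ℤ → ℂ := fun n => fourierCoeffOn ha g n
  let d : ℤ → ℂ := fun n => fourierCoeffOn ha g' n
  have hpars : HasSum (fun n => ‖d n‖ ^ 2) ((a + T - a)⁻¹ • ∫ x in a..(a + T), ‖g' x‖ ^ 2) := by
    refine hasSum_sq_fourierCoeffOn ha ?_
    refine (MemLp.of_bound (C := D) hgc'.aestronglyMeasurable ?_)
    refine (ae_restrict_iff' measurableSet_Ioc).2 (Eventually.of_forall fun x hx => ?_)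
    exact hgb' x ⟨hx.1.le, haT ▸ hx.2⟩
  have hparsle : (a + T - a)⁻¹ • ∫ x in a..(a + T), ‖g' x‖ ^ 2 ≤ D ^ 2 := by
    have : ∫ x in a..(a + T), ‖g' x‖ ^ 2 ≤ ∫ x in a..(a + T), D ^ 2 := by
      refine intervalIntegral.integral_mono_on ha.le
        (by apply Continuous.intervalIntegrable; fun_prop) (by simp) fun x hx => ?_
      have := hgb' x ⟨hx.1, haT ▸ hx.2⟩
      gcongr
    rw [intervalIntegral.integral_const] at this
    simp only [add_sub_cancel_left, smul_eq_mul] at this ⊢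
    rw [inv_mul_le_iff₀ hT]; exact this
  have hA0 : ‖A 0‖ ≤ δ := by
    simp only [A]
    rw [fourierCoeffOn_eq_integral, norm_smul]
    have : ‖∫ x in a..(a + T), (fourier (-0) (x : AddCircle (a + T - a))) • g x‖
        ≤ δ * |a + T - a| := by
      refine intervalIntegral.norm_integral_le_of_norm_le_const fun x hx => ?_
      rw [Set.uIoc_of_le ha.le] at hx
      simp only [neg_zero, fourier_zero, one_smul]
      exact hgb x ⟨hx.1.le, haT ▸ hx.2⟩
    simp only [add_sub_cancel_left] at this ⊢
    rw [abs_of_pos hT] at this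
    rw [Real.norm_of_nonneg (by positivity), one_div, inv_mul_le_iff₀ hT, mul_comm]
    exact this
  have hAn : ∀ n : ℤ, ‖A n‖ ≤ (if n = 0 then δ else 0) +
      T * (D * (1 / (n : ℝ) ^ 2) + D⁻¹ * ‖d n‖ ^ 2) := by
    intro n
    by_cases hn : n = 0
    · subst hn
      have : 0 ≤ T * (D * (1 / ((0 : ℤ) : ℝ) ^ 2) + D⁻¹ * ‖d 0‖ ^ 2) := by positivity
      simp only [if_true]; linarith
    · have key : A n = 1 / (-2 * Real.pi * Complex.I * n) *
          (fourier (-n) (a : AddCircle (a + T - a)) * (g (a + T) - g a) -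
            ((a + T : ℝ) - a) * d n) := by
        exact fourierCoeffOn_of_hasDerivAt ha hn (fun x _ => hg x) (hgc'.intervalIntegrable _ _)
      rw [hga, hgb0] at key
      have hn1 : (0 : ℝ) < |(n : ℝ)| := by positivity
      have e : ‖A n‖ = (2 * Real.pi * |(n : ℝ)|)⁻¹ * (T * ‖d n‖) := by
        rw [key]
        simp [abs_of_pos Real.pi_pos, abs_of_pos hT]
      have e2 : ‖A n‖ ≤ T * (|(n : ℝ)|⁻¹ * ‖d n‖) := by
        rw [e]
        have : (2 * Real.pi * |(n : ℝ)|)⁻¹ ≤ |(n : ℝ)|⁻¹ := by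
          apply inv_anti₀ hn1
          have := Real.pi_gt_three
          nlinarith
        calc _ ≤ |(n : ℝ)|⁻¹ * (T * ‖d n‖) := by gcongr
          _ = _ := by ring
      simp only [hn, if_false, zero_add]
      refine e2.trans ?_
      gcongr
      rw [← sq_abs (n : ℝ)]
      set u := |(n : ℝ)|⁻¹ with hu
      have hu0 : 0 < u := inv_pos.2 hn1
      have : 1 / |(n : ℝ)| ^ 2 = u ^ 2 := by rw [hu]; field_simp
      rw [this]
      have h3 : D * (u * ‖d n‖) ≤ D * (D * u ^ 2 + D⁻¹ * ‖d n‖ ^ 2) := by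
        have : D * (D * u ^ 2 + D⁻¹ * ‖d n‖ ^ 2) = (D * u) ^ 2 + ‖d n‖ ^ 2 := by
          field_simp
        rw [this]
        nlinarith [sq_nonneg (D * u - ‖d n‖), mul_nonneg (mul_nonneg hD.le hu0.le) (norm_nonneg (d n))]
      exact le_of_mul_le_mul_left h3 hD
  have hbsum := (hasSum_ite_eq (0 : ℤ) δ).add
    (((hZ.mul_left D).add (hpars.mul_left D⁻¹)).mul_left T)
  have hAs : Summable fun n => ‖A n‖ :=
    Summable.of_nonneg_of_le (fun _ => norm_nonneg _) hAn hbsum.summable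
  have hAle : ∑' n, ‖A n‖ ≤ (1 + T * ((M + 1) * Z + (M + 1))) * δ := by
    refine (hAs.hasSum.tsum_eq ▸ hasSum_le hAn hAs.hasSum hbsum).trans ?_
    have : D⁻¹ * ((a + T - a)⁻¹ • ∫ x in a..(a + T), ‖g' x‖ ^ 2) ≤ D := by
      rw [inv_mul_le_iff₀ hD, ← sq]; exact hparsle
    calc _ ≤ δ + T * (D * Z + D) := by gcongr
      _ = _ := by simp only [D]; ring
  have hcl : Continuous (AddCircle.liftIco T a g) :=
    AddCircle.liftIco_continuous (by rw [hga, hgb0]) hgc.continuousOn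
  have hco : ∀ n, fourierCoeff (⟨_, hcl⟩ : C(AddCircle T, ℂ)) n = A n := fun n =>
    fourierCoeff_liftIco_eq g n
  have hmass : ∫⁻ n, ‖A n‖ₑ ∂(Measure.count : Measure ℤ)
      ≤ ENNReal.ofReal ((1 + T * ((M + 1) * Z + (M + 1))) * δ) := by
    rw [lintegral_count]
    simp only [← ofReal_norm]
    rw [← ENNReal.ofReal_tsum_of_nonneg (fun _ => norm_nonneg _) hAs]
    exact ENNReal.ofReal_le_ofReal hAle
  have mξ : Measurable (fun n : ℤ => 2 * Real.pi * n / T) := measurable_of_countable _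
  refine ⟨ℤ, inferInstance, Measure.count, fun n => 2 * Real.pi * n / T, A, inferInstance,
    mξ, measurable_of_countable _, hmass, fun x hx => ?_⟩
  have hs := has_pointwise_sum_fourier_series_of_summable (f := (⟨_, hcl⟩ : C(AddCircle T, ℂ)))
    (by rw [funext hco]; exact hAs.of_norm) (x : AddCircle T)
  have hxI : x ∈ Set.Ico a (a + T) := by
    rw [haT]; simp only [a]; exact ⟨by linarith [hx.1], by linarith [hx.2]⟩
  have hgx : g x = h x := by
    simp only [g]
    rw [χ.one_of_mem_closedBall (by simpa [χ, abs_le] using hx)]; simp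
  have hval : (⟨_, hcl⟩ : C(AddCircle T, ℂ)) (x : AddCircle T) = h x := by
    rw [← hgx]; exact AddCircle.liftIco_coe_apply (f := g) (p := T) (a := a) hxI
  rw [hval] at hs
  rw [integral_countable (integrable_mul_exp (by fun_prop) (measurable_of_countable _)
    (ne_top_of_le_ne_top ENNReal.ofReal_ne_top hmass)), ← hs.tsum_eq]
  refine tsum_congr fun n => ?_
  rw [hco, fourier_coe_apply]
  simp only [smul_eq_mul, Measure.real, Measure.count_singleton, ENNReal.toReal_one, one_smul]
  congr 2
  push_cast
  ring

lemma exists_antideriv (p : Polynomial ℂ) (z : ℂ) :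
    ∃ q : Polynomial ℂ, Polynomial.derivative q = p ∧ q.eval 0 = z := by
  induction p using Polynomial.induction_on' generalizing z with
  | add p p' hp hp' =>
    obtain ⟨q, h1, h2⟩ := hp z
    obtain ⟨q', h1', h2'⟩ := hp' 0
    exact ⟨q + q', by simp [h1, h1'], by simp [h2, h2']⟩
  | monomial n a =>
    refine ⟨Polynomial.monomial (n + 1) (a / (n + 1)) + Polynomial.C z, ?_, ?_⟩
    · have : (n : ℂ) + 1 ≠ 0 := by exact_mod_cast Nat.succ_ne_zero n
      simp [div_mul_cancel₀ _ this]
    · simp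

lemma hasDerivAt_poly (q : Polynomial ℂ) (x : ℝ) :
    HasDerivAt (fun x : ℝ => q.eval (x : ℂ)) ((Polynomial.derivative q).eval (x : ℂ)) x :=
  (q.hasDerivAt (x : ℂ)).comp_ofReal

lemma poly_approx (n : ℕ) : ∀ (F : ℕ → ℝ → ℂ) (_ : ∀ m < n, ∀ x, HasDerivAt (F m) (F (m + 1) x) x)
    (_ : Continuous (F n)) (R : ℝ) (_ : 0 < R) (ε : ℝ) (_ : 0 < ε),
    ∃ q : Polynomial ℂ, ∀ m ≤ n, ∀ x ∈ Set.Icc (-R) R,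
      ‖F m x - (Polynomial.derivative^[m] q).eval (x : ℂ)‖ ≤ ε := by
  induction n with
  | zero =>
    intro F _ hF R hR ε hε
    obtain ⟨p1, h1⟩ := exists_polynomial_near_of_continuousOn (-R) R (fun x => (F 0 x).re)
      (Complex.continuous_re.comp hF).continuousOn (ε / 2) (by linarith)
    obtain ⟨p2, h2⟩ := exists_polynomial_near_of_continuousOn (-R) R (fun x => (F 0 x).im)
      (Complex.continuous_im.comp hF).continuousOn (ε / 2) (by linarith)
    refine ⟨p1.map Complex.ofRealHom + Polynomial.C Complex.I * p2.map Complex.ofRealHom,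
      fun m hm x hx => ?_⟩
    obtain rfl : m = 0 := by omega
    have e : ∀ p : Polynomial ℝ, (p.map Complex.ofRealHom).eval (x : ℂ) = ((p.eval x : ℝ) : ℂ) :=
      fun p => Polynomial.eval_map_apply (f := Complex.ofRealHom) (p := p) x
    simp only [Function.iterate_zero, id, Polynomial.eval_add, Polynomial.eval_mul,
      Polynomial.eval_C, e]
    refine (Complex.norm_le_abs_re_add_abs_im _).trans ?_
    have := h1 x hx
    have := h2 x hx
    rw [abs_sub_comm] at *
    simp
    linarith
  | succ n ih =>
    intro F hd hF R hR ε hε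
    obtain ⟨p, hp⟩ := ih (fun m => F (m + 1)) (fun m hm => hd (m + 1) (by omega)) hF R hR
      (ε / (1 + R)) (by positivity)
    obtain ⟨q, hq, hq0⟩ := exists_antideriv p (F 0 0)
    refine ⟨q, fun m hm x hx => ?_⟩
    have hle : ε / (1 + R) ≤ ε := div_le_self hε.le (by linarith)
    rcases m with _ | m
    · have hmv := (convex_Icc (-R) R).norm_image_sub_le_of_norm_hasDerivWithin_le
        (f := fun x => F 0 x - q.eval (x : ℂ)) (f' := fun x => F 1 x - p.eval (x : ℂ))
        (C := ε / (1 + R))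
        (fun y _ => ((hd 0 (by omega) y).sub (hq ▸ hasDerivAt_poly q y)).hasDerivWithinAt)
        (fun y hy => by simpa using hp 0 (by omega) y hy)
        (x := 0) ⟨by linarith, hR.le⟩ hx
      simp only [Complex.ofReal_zero, hq0, sub_self, sub_zero] at hmv
      simp only [Function.iterate_zero, id]
      refine hmv.trans ?_
      have hxR : ‖x‖ ≤ R := abs_le.2 hx
      calc ε / (1 + R) * ‖x‖ ≤ ε / (1 + R) * (1 + R) := by gcongr; linarith
        _ = ε := by field_simp
    · rw [Function.iterate_succ_apply, hq]
      exact (hp m (by omega) x hx).trans hle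

lemma iteratedDeriv_chain {n : ℕ} {F : ℕ → ℝ → ℂ}
    (hF : ∀ m < n, ∀ x, HasDerivAt (F m) (F (m + 1) x) x) :
    ∀ j ≤ n, iteratedDeriv j (F 0) = F j := by
  intro j
  induction j with
  | zero => intro _; simp
  | succ j ih =>
    intro hj
    rw [iteratedDeriv_succ, ih (by omega)]
    exact funext fun x => (hF j (by omega) x).deriv

lemma cNorm_le {k : ℕ} {r : ℝ} {f : ℝ → ℂ} {F : ℕ → ℝ → ℂ} {C : ℝ≥0∞} (hC : C ≠ ∞)
    (hF : ∀ m < k, ∀ x, HasDerivAt (F m) (F (m + 1) x) x) (hf : f = F 0)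
    (H : ∀ j ≤ k, ExpRep r (F j) C) : cNorm k r f ≤ (k + 1 : ℕ) * C := by
  subst hf
  unfold cNorm
  calc _ ≤ ∑ j ∈ Finset.range (k + 1), C := by
        refine Finset.sum_le_sum fun j hj => ?_
        have hj : j ≤ k := by simpa [Nat.lt_succ_iff] using hj
        apply iptNormIcc_le hC
        rw [iteratedDeriv_chain hF j hj]
        exact H j hj
    _ = _ := by simp

/-- Quantitative polynomial approximation of `C^{k+1}` chains, for all radii at once. -/
lemma chain_approx {k : ℕ} {F : ℕ → ℝ → ℂ}
    (hF : ∀ m < k + 1, ∀ x, HasDerivAt (F m) (F (m + 1) x) x) (hc : Continuous (F (k + 1)))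
    {C r : ℝ}
    (HC : ∀ h h' : ℝ → ℂ,
    (∀ x, HasDerivAt h (h' x) x) → Continuous h' → ∀ δ : ℝ, 0 < δ →
    (∀ x ∈ Set.Icc (-(2 * r)) (2 * r), ‖h x‖ ≤ δ ∧ ‖h' x‖ ≤ δ) →
    ExpRep r h (ENNReal.ofReal (C * δ))) {δ R : ℝ} (hδ : 0 < δ) (hrR : r ≤ R)
    (hb : ∀ m ≤ k + 1, ∀ x ∈ Set.Icc (-(2 * R)) (2 * R), ‖F m x‖ ≤ δ) :
    ∀ j ≤ k, ExpRep r (F j) (ENNReal.ofReal (C * δ)) := by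
  intro j hj
  refine HC (F j) (F (j + 1)) (hF j (by omega)) ?_ δ hδ fun x hx => ?_
  · rcases hj.lt_or_eq with h | h
    · exact continuous_iff_continuousAt.2 fun x => (hF (j + 1) (by omega) x).continuousAt
    · rw [h]; exact hc
  · have hx' : x ∈ Set.Icc (-(2 * R)) (2 * R) := ⟨by linarith [hx.1], by linarith [hx.2]⟩
    exact ⟨hb j (by omega) x hx', hb (j + 1) (by omega) x hx'⟩

lemma chain_sub {n : ℕ} {F : ℕ → ℝ → ℂ} (q : Polynomial ℂ)
    (hF : ∀ m < n, ∀ x, HasDerivAt (F m) (F (m + 1) x) x) :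
    ∀ m < n, ∀ x, HasDerivAt (fun x => F m x - (Polynomial.derivative^[m] q).eval (x : ℂ))
      (F (m + 1) x - (Polynomial.derivative^[m + 1] q).eval (x : ℂ)) x := by
  intro m hm x
  rw [Function.iterate_succ_apply']
  exact (hF m hm x).sub (hasDerivAt_poly _ x)

lemma part_two (k : ℕ) (f : ℝ → ℂ) (hf : ContDiff ℝ ((k + 1 : ℕ) : ℕ∞) f) :
    (∀ r : ℝ, 0 < r → cNorm k r f ≠ ∞) ∧
        ∃ q : ℕ → Polynomial ℂ, ∀ r : ℝ, 0 < r →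
          Filter.Tendsto (fun n => cNorm k r (fun x => f x - (q n).eval (x : ℂ)))
            Filter.atTop (nhds 0) := by
  let F : ℕ → ℝ → ℂ := fun m => iteratedDeriv m f
  have hF : ∀ m < k + 1, ∀ x, HasDerivAt (F m) (F (m + 1) x) x := by
    intro m hm x
    simp only [F]
    rw [iteratedDeriv_succ]
    exact (hf.differentiable_iteratedDeriv m (by exact_mod_cast hm) x).hasDerivAt
  have hc : ∀ m ≤ k + 1, Continuous (F m) := fun m hm =>
    hf.continuous_iteratedDeriv m (by exact_mod_cast hm)
  have hF0 : f = F 0 := by simp [F]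
  constructor
  · intro r hr
    obtain ⟨C, hC, HC⟩ := expRep_of_C1 r hr
    have hbd : ∀ m, ∃ B, m ≤ k + 1 → ∀ x ∈ Set.Icc (-(2 * r)) (2 * r), ‖F m x‖ ≤ B := by
      intro m
      by_cases hm : m ≤ k + 1
      · obtain ⟨B, hB⟩ := (isCompact_Icc (a := -(2 * r)) (b := 2 * r)).exists_bound_of_continuousOn
          (hc m hm).continuousOn
        exact ⟨B, fun _ => hB⟩
      · exact ⟨0, fun h => absurd h hm⟩
    choose B hB using hbd
    have hle : ∀ m ≤ k + 1, B m ≤ 1 + ∑ i ∈ Finset.range (k + 2), |B i| := fun m hm => by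
      have := Finset.single_le_sum (f := fun i => |B i|) (fun i _ => abs_nonneg _)
        (Finset.mem_range.2 (show m < k + 2 by omega))
      have := le_abs_self (B m)
      linarith
    have hpos : 0 < 1 + ∑ i ∈ Finset.range (k + 2), |B i| := by positivity
    refine ne_top_of_le_ne_top ?_ (cNorm_le ENNReal.ofReal_ne_top (fun m hm => hF m (by omega)) hF0
      (chain_approx hF (hc _ le_rfl) HC hpos le_rfl
        fun m hm x hx => (hB m hm x hx).trans (hle m hm)))
    exact ENNReal.mul_ne_top (ENNReal.natCast_ne_top _) ENNReal.ofReal_ne_top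
  · choose q hq using fun n : ℕ => poly_approx (k + 1) F hF (hc _ le_rfl) (2 * (n + 1))
      (by positivity) (1 / ((n : ℝ) + 1)) (by positivity)
    refine ⟨q, fun r hr => ?_⟩
    obtain ⟨C, hC, HC⟩ := expRep_of_C1 r hr
    have hlim : Tendsto (fun n : ℕ => ((k + 1 : ℕ) : ℝ≥0∞) *
        ENNReal.ofReal (C * (1 / ((n : ℝ) + 1)))) atTop (nhds 0) := by
      have h1 : Tendsto (fun n : ℕ => C * (1 / ((n : ℝ) + 1))) atTop (nhds 0) := by
        simpa using (tendsto_one_div_add_atTop_nhds_zero_nat (𝕜 := ℝ)).const_mul C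
      have h2 := ENNReal.Tendsto.const_mul (a := ((k + 1 : ℕ) : ℝ≥0∞)) (ENNReal.tendsto_ofReal h1)
        (Or.inr (ENNReal.natCast_ne_top _))
      simpa using h2
    refine tendsto_of_tendsto_of_tendsto_of_le_of_le' tendsto_const_nhds hlim
      (Eventually.of_forall fun _ => zero_le) ?_
    filter_upwards [eventually_ge_atTop ⌈r⌉₊] with n hn
    have hrn : r ≤ (n : ℝ) + 1 := by
      have := Nat.le_ceil r
      have : (⌈r⌉₊ : ℝ) ≤ n := by exact_mod_cast hn
      linarith
    have hch := chain_sub (q n) hF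
    have hcq : Continuous fun x : ℝ =>
        F (k + 1) x - (Polynomial.derivative^[k + 1] (q n)).eval (x : ℂ) := by
      have := hc (k + 1) le_rfl
      fun_prop
    refine cNorm_le (F := fun m x => F m x - (Polynomial.derivative^[m] (q n)).eval (x : ℂ))
      ENNReal.ofReal_ne_top (fun m hm => hch m (by omega)) (by simp [F]) ?_
    exact chain_approx hch hcq HC (by positivity) hrn (hq n)

/-- The formal `m`-th derivative of the Fourier transform of `h ν`. -/
noncomputable def wien (ν : Measure ℝ) (h : ℝ → ℂ) (m : ℕ) (x : ℝ) : ℂ :=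
  ∫ ξ, ((Complex.I * (ξ : ℂ)) ^ m * h ξ) * Complex.exp (((x * ξ : ℝ) : ℂ) * Complex.I) ∂ν

lemma wien_enorm {h : ℝ → ℂ} (hh : ∀ ξ, ‖h ξ‖ = 1) (m : ℕ) (ξ : ℝ) :
    ‖(Complex.I * (ξ : ℂ)) ^ m * h ξ‖ₑ = (‖ξ‖₊ : ℝ≥0∞) ^ m := by
  have : ‖(Complex.I * (ξ : ℂ)) ^ m * h ξ‖ = ‖ξ‖ ^ m := by
    simp [hh]
  rw [← ofReal_norm, this, ← enorm_eq_nnnorm, ← ofReal_norm, ENNReal.ofReal_pow (norm_nonneg _)]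

lemma wien_integrable {ν : Measure ℝ} {h : ℝ → ℂ} (hm : Measurable h) (hh : ∀ ξ, ‖h ξ‖ = 1)
    {m : ℕ} (hfin : (∫⁻ ξ, (‖ξ‖₊ : ℝ≥0∞) ^ m ∂ν) ≠ ∞) (x : ℝ) :
    Integrable (fun ξ : ℝ => ((Complex.I * (ξ : ℂ)) ^ m * h ξ) *
      Complex.exp (((x * ξ : ℝ) : ℂ) * Complex.I)) ν := by
  refine integrable_mul_exp (by fun_prop) (by fun_prop) ?_
  simpa only [wien_enorm hh] using hfin

lemma wien_deriv {ν : Measure ℝ} {h : ℝ → ℂ} (hm : Measurable h) (hh : ∀ ξ, ‖h ξ‖ = 1)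
    {m : ℕ} (hfin : (∫⁻ ξ, (‖ξ‖₊ : ℝ≥0∞) ^ m ∂ν) ≠ ∞)
    (hfin' : (∫⁻ ξ, (‖ξ‖₊ : ℝ≥0∞) ^ (m + 1) ∂ν) ≠ ∞) (x : ℝ) :
    HasDerivAt (wien ν h m) (wien ν h (m + 1) x) x := by
  refine (hasDerivAt_integral_of_dominated_loc_of_deriv_le (s := Set.univ)
    (F := fun (y ξ : ℝ) => ((Complex.I * (ξ : ℂ)) ^ m * h ξ) *
      Complex.exp (((y * ξ : ℝ) : ℂ) * Complex.I))
    (F' := fun (y ξ : ℝ) => ((Complex.I * (ξ : ℂ)) ^ (m + 1) * h ξ) *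
      Complex.exp (((y * ξ : ℝ) : ℂ) * Complex.I)) Filter.univ_mem
    (Eventually.of_forall fun y => (wien_integrable hm hh hfin y).aestronglyMeasurable)
    (wien_integrable hm hh hfin x) (wien_integrable hm hh hfin' x).aestronglyMeasurable
    (bound := fun ξ : ℝ => ‖((Complex.I * (ξ : ℂ)) ^ (m + 1) * h ξ) *
      Complex.exp (((x * ξ : ℝ) : ℂ) * Complex.I)‖)
    (Eventually.of_forall fun ξ y _ => ?_) (wien_integrable hm hh hfin' x).norm
    (Eventually.of_forall fun ξ y _ => ?_)).2
  · rw [norm_mul, norm_mul _ (Complex.exp _), Complex.norm_exp_ofReal_mul_I,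
      Complex.norm_exp_ofReal_mul_I]
  · have h1 : HasDerivAt (fun y : ℝ => (((y * ξ : ℝ) : ℂ) * Complex.I)) ((ξ : ℂ) * Complex.I) y := by
      have := (((hasDerivAt_id y).mul_const ξ).ofReal_comp).mul_const Complex.I
      simpa using this
    have h2 := (h1.cexp).const_mul ((Complex.I * (ξ : ℂ)) ^ m * h ξ)
    have e : ((Complex.I * (ξ : ℂ)) ^ (m + 1) * h ξ) *
        Complex.exp (((y * ξ : ℝ) : ℂ) * Complex.I) = (Complex.I * (ξ : ℂ)) ^ m * h ξ *
        (Complex.exp (((y * ξ : ℝ) : ℂ) * Complex.I) * ((ξ : ℂ) * Complex.I)) := by ring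
    beta_reduce
    rw [e]
    exact h2

lemma wien_rep {ν : Measure ℝ} [IsFiniteMeasure ν] {h : ℝ → ℂ} (hm : Measurable h)
    (hh : ∀ ξ, ‖h ξ‖ = 1) (m : ℕ) (r : ℝ) {C : ℝ≥0∞}
    (hC : (∫⁻ ξ, (‖ξ‖₊ : ℝ≥0∞) ^ m ∂ν) ≤ C) : ExpRep r (wien ν h m) C := by
  refine ⟨ℝ, inferInstance, ν, id, fun ξ => (Complex.I * (ξ : ℂ)) ^ m * h ξ, inferInstance,
    measurable_id, by fun_prop, ?_, fun x _ => rfl⟩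
  simpa only [wien_enorm hh] using hC

lemma pow_le_one_add {j k : ℕ} (hjk : j ≤ k) (a : ℝ≥0∞) : a ^ j ≤ 1 + a ^ k := by
  rcases le_total a 1 with h | h
  · exact (pow_le_one₀ zero_le h).trans le_self_add
  · exact (pow_le_pow_right₀ h hjk).trans le_add_self

lemma part_one (k : ℕ) (f : ℝ → ℂ) (hf : memWiener k f) :
    (∀ r : ℝ, 0 < r → cNorm k r f ≠ ∞) ∧
        ∃ q : ℕ → Polynomial ℂ, ∀ r : ℝ, 0 < r →
          Filter.Tendsto (fun n => cNorm k r (fun x => f x - (q n).eval (x : ℂ)))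
            Filter.atTop (nhds 0) := by
  obtain ⟨ν, h, hν, hm, hh, hk, hfe⟩ := hf
  have hf0 : f = wien ν h 0 := by
    funext x
    rw [hfe, wien]
    refine integral_congr_ae (Eventually.of_forall fun ξ => ?_)
    simp only [pow_zero, one_mul]
    rw [mul_comm]
    congr 2
    push_cast
    ring
  have hint : ∫⁻ ξ, (1 + (‖ξ‖₊ : ℝ≥0∞) ^ k) ∂ν ≠ ∞ := by
    rw [lintegral_add_left measurable_const]
    simp [hk]
  have hfin : ∀ j ≤ k, ∫⁻ ξ, (‖ξ‖₊ : ℝ≥0∞) ^ j ∂ν ≤ ∫⁻ ξ, (1 + (‖ξ‖₊ : ℝ≥0∞) ^ k) ∂ν :=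
    fun j hj => lintegral_mono fun ξ => pow_le_one_add hj _
  constructor
  · intro r hr
    refine ne_top_of_le_ne_top ?_ (cNorm_le (F := wien ν h) hint (fun m hmk x => ?_) hf0
      (fun j hj => wien_rep hm hh j r (hfin j hj)))
    · exact ENNReal.mul_ne_top (ENNReal.natCast_ne_top _) hint
    · exact wien_deriv hm hh (ne_top_of_le_ne_top hint (hfin m (by omega)))
        (ne_top_of_le_ne_top hint (hfin (m + 1) (by omega))) x
  · let A : ℕ → Set ℝ := fun n => Metric.closedBall 0 n
    have hA : ∀ n, MeasurableSet (A n) := fun n => measurableSet_closedBall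
    let G : ℕ → ℕ → ℝ → ℂ := fun n => wien (ν.restrict (A n)) h
    let U : ℕ → ℕ → ℝ → ℂ := fun n => wien (ν.restrict (A n)ᶜ) h
    let τ : ℕ → ℝ≥0∞ := fun n => ∫⁻ ξ in (A n)ᶜ, (1 + (‖ξ‖₊ : ℝ≥0∞) ^ k) ∂ν
    have hτ : Tendsto τ atTop (nhds 0) := by
      refine tendsto_setLIntegral_zero hint ?_
      have hanti : Antitone fun n => (A n)ᶜ := fun a b hab =>
        Set.compl_subset_compl.2 (Metric.closedBall_subset_closedBall (by exact_mod_cast hab))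
      have := tendsto_measure_iInter_atTop (μ := ν) (s := fun n => (A n)ᶜ)
        (fun n => (hA n).compl.nullMeasurableSet) hanti ⟨0, measure_ne_top _ _⟩
      have he : ⋂ n, (A n)ᶜ = ∅ := by
        rw [← Set.compl_iUnion, Set.compl_empty_iff]
        exact Metric.iUnion_closedBall_nat 0
      rw [he, measure_empty] at this
      exact this
    have hτfin : ∀ n, τ n ≠ ∞ := fun n => ne_top_of_le_ne_top hint (setLIntegral_le_lintegral _ _)
    have hUfin : ∀ n, ∀ j ≤ k, ∫⁻ ξ in (A n)ᶜ, (‖ξ‖₊ : ℝ≥0∞) ^ j ∂ν ≤ τ n :=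
      fun n j hj => lintegral_mono fun ξ => pow_le_one_add hj _
    have hGfin : ∀ n j, ∫⁻ ξ in A n, (‖ξ‖₊ : ℝ≥0∞) ^ j ∂ν ≠ ∞ := by
      intro n j
      have : ∫⁻ ξ in A n, (‖ξ‖₊ : ℝ≥0∞) ^ j ∂ν ≤ ∫⁻ ξ in A n, (n : ℝ≥0∞) ^ j ∂ν := by
        refine setLIntegral_mono measurable_const fun ξ hξ => ?_
        have h1 : ‖ξ‖ ≤ n := by simpa [A] using hξ
        have h2 : ‖ξ‖₊ ≤ (n : ℝ≥0) := by exact_mod_cast h1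
        have h3 : (‖ξ‖₊ : ℝ≥0∞) ≤ (n : ℝ≥0∞) := by exact_mod_cast h2
        gcongr
      refine ne_top_of_le_ne_top ?_ this
      rw [lintegral_const]
      exact ENNReal.mul_ne_top (ENNReal.pow_ne_top (ENNReal.natCast_ne_top _)) (measure_ne_top _ _)
    have hG : ∀ n m x, HasDerivAt (G n m) (G n (m + 1) x) x := fun n m x =>
      wien_deriv hm hh (hGfin n m) (hGfin n (m + 1)) x
    have hGc : ∀ n m, Continuous (G n m) := fun n m =>
      continuous_iff_continuousAt.2 fun x => (hG n m x).continuousAt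
    have hU : ∀ n, ∀ m < k, ∀ x, HasDerivAt (U n m) (U n (m + 1) x) x := fun n m hmk x =>
      wien_deriv hm hh (ne_top_of_le_ne_top (hτfin n) (hUfin n m (by omega)))
        (ne_top_of_le_ne_top (hτfin n) (hUfin n (m + 1) (by omega))) x
    have hfGU : ∀ n x, f x = U n 0 x + G n 0 x := by
      intro n x
      rw [hf0, add_comm]
      simp only [G, U, wien]
      exact (integral_add_compl (hA n) (wien_integrable hm hh
        (ne_top_of_le_ne_top hint (hfin 0 (by omega))) x)).symm
    choose q hq using fun n : ℕ => poly_approx (k + 1) (G n) (fun m _ x => hG n m x) (hGc n _)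
      (2 * (n + 1)) (by positivity) (1 / ((n : ℝ) + 1)) (by positivity)
    refine ⟨q, fun r hr => ?_⟩
    obtain ⟨C, hC, HC⟩ := expRep_of_C1 r hr
    have hlim : Tendsto (fun n : ℕ => ((k + 1 : ℕ) : ℝ≥0∞) *
        (τ n + ENNReal.ofReal (C * (1 / ((n : ℝ) + 1))))) atTop (nhds 0) := by
      have h1 : Tendsto (fun n : ℕ => C * (1 / ((n : ℝ) + 1))) atTop (nhds 0) := by
        simpa using (tendsto_one_div_add_atTop_nhds_zero_nat (𝕜 := ℝ)).const_mul C
      have h2 := ENNReal.Tendsto.const_mul (a := ((k + 1 : ℕ) : ℝ≥0∞))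
        (hτ.add (ENNReal.tendsto_ofReal h1)) (Or.inr (ENNReal.natCast_ne_top _))
      simpa using h2
    refine tendsto_of_tendsto_of_tendsto_of_le_of_le' tendsto_const_nhds hlim
      (Eventually.of_forall fun _ => zero_le) ?_
    filter_upwards [eventually_ge_atTop ⌈r⌉₊] with n hn
    have hrn : r ≤ (n : ℝ) + 1 := by
      have := Nat.le_ceil r
      have : (⌈r⌉₊ : ℝ) ≤ n := by exact_mod_cast hn
      linarith
    have hch := chain_sub (n := k + 1) (q n) (fun m _ x => hG n m x)
    have hcq : Continuous fun x : ℝ =>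
        G n (k + 1) x - (Polynomial.derivative^[k + 1] (q n)).eval (x : ℂ) := by
      have := hGc n (k + 1)
      fun_prop
    refine cNorm_le
      (F := fun m x => U n m x + (G n m x - (Polynomial.derivative^[m] (q n)).eval (x : ℂ)))
      (ENNReal.add_ne_top.2 ⟨hτfin n, ENNReal.ofReal_ne_top⟩)
      (fun m hmk x => (hU n m hmk x).add (hch m (by omega) x)) ?_ fun j hj => ?_
    · funext x
      rw [hfGU n x]
      simp only [Function.iterate_zero, id]
      ring
    · exact ExpRep.add (hτfin n) ENNReal.ofReal_ne_top (wien_rep hm hh j r (hUfin n j hj))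
        (chain_approx hch hcq HC (by positivity) hrn (hq n) j hj)

/-- Theorem 3.8: `W_k(ℝ) ⊆ NC^k(ℝ)` and `C^{k+1}(ℝ) ⊆ NC^k(ℝ)`: every
`f ∈ W_k(ℝ)` (respectively every `f ∈ C^{k+1}(ℝ)`) belongs to `𝒞^{[k]}(ℝ)` (i.e.
`‖f‖_{𝒞^{[k]},r} < ∞` for all `r > 0`) and admits a sequence of polynomials `(q_n)` with
`‖f - q_n‖_{𝒞^{[k]},r} → 0` for every `r > 0`; hence the closures of `W_k(ℝ)` and of
`C^{k+1}(ℝ)` in `𝒞^{[k]}(ℝ)` both equal `NC^k(ℝ)`. -/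
theorem stmt_1 (k : ℕ) (hk : 1 ≤ k) :
    (∀ f : ℝ → ℂ, memWiener k f →
        (∀ r : ℝ, 0 < r → cNorm k r f ≠ ∞) ∧
        ∃ q : ℕ → Polynomial ℂ, ∀ r : ℝ, 0 < r →
          Filter.Tendsto (fun n => cNorm k r (fun x => f x - (q n).eval (x : ℂ)))
            Filter.atTop (nhds 0)) ∧
    (∀ f : ℝ → ℂ, ContDiff ℝ ((k + 1 : ℕ) : ℕ∞) f →
        (∀ r : ℝ, 0 < r → cNorm k r f ≠ ∞) ∧
        ∃ q : ℕ → Polynomial ℂ, ∀ r : ℝ, 0 < r →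
          Filter.Tendsto (fun n => cNorm k r (fun x => f x - (q n).eval (x : ℂ)))
            Filter.atTop (nhds 0)) := by
  exact ⟨part_one k, part_two k⟩
end

section
/- Fix k ∈ ℕ. Let ψ ∈ C_c^∞(ℝ) satisfy ψ ≡ 1 on [-1,1] and supp ψ ⊆ [-2,2], and define κ(x) := 1_{(0,∞)}(x) ψ(x) √x e^{-i/x} for x ∈ ℝ. If f ∈ C^k(ℝ) satisfies f^{(k)} = κ, then f^{(k)} is (1/4)-Hölder continuous on ℝ, but f ∉ W_k(ℝ)_loc; in particular W_k(ℝ)_loc is a proper subset of C_loc^{k,1/4}(ℝ). -/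
open MeasureTheory Filter
open scoped ENNReal NNReal

lemma aux_neg (d : ℝ) (hd : 0 ≤ d) (b : ℝ) (hb : 1 ≤ b) :
    ‖∫ s in (1:ℝ)..b, Complex.exp (Complex.I * ((s^2 - d / s^2 : ℝ) : ℂ))‖ ≤ 5 := by
  set e : ℝ → ℂ := fun s => Complex.exp (Complex.I * ((s^2 - d / s^2 : ℝ) : ℂ)) with he
  set q : ℝ → ℝ := fun s => s^3 / (2 * (s^4 + d)) with hq
  set dq : ℝ → ℝ := fun s => (3 * s^2 * (2 * (s^4 + d)) - s^3 * (2 * (4 * s^3))) / (2 * (s^4 + d))^2 with hdq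
  have hpos : ∀ s ∈ Set.uIcc 1 b, 0 < s := by
    intro s hs
    rw [Set.uIcc_of_le hb] at hs
    linarith [hs.1]
  have hpd : ∀ s : ℝ, 0 < s → 0 < s^4 + d := fun s hs => by positivity
  have hφ : ∀ s : ℝ, 0 < s → HasDerivAt (fun s : ℝ => s^2 - d / s^2) (2 * s + 2 * d / s^3) s := by
    intro s hs
    have h1 := (hasDerivAt_pow 2 s)
    have h2 := (h1.inv (by positivity)).const_mul d
    have h3 : HasDerivAt (fun s : ℝ => s^2 - d * (s^2)⁻¹) _ s := h1.sub h2
    simp only [div_eq_mul_inv d]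
    refine h3.congr_deriv ?_
    simp; field_simp; ring
  have hqd : ∀ s : ℝ, 0 < s → HasDerivAt q (dq s) s := by
    intro s hs
    have h1 := (hasDerivAt_pow 3 s)
    have h2 := (((hasDerivAt_pow 4 s).add_const d).const_mul 2)
    refine (h1.div h2 (by have := hpd s hs; positivity)).congr_deriv ?_
    simp [hdq]
  have hed : ∀ s : ℝ, 0 < s → HasDerivAt e (e s * (Complex.I * ((2 * s + 2 * d / s^3 : ℝ) : ℂ))) s := by
    intro s hs
    exact ((hφ s hs).ofReal_comp.const_mul Complex.I).cexp
  have hen : ∀ s, ‖e s‖ = 1 := by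
    intro s
    rw [he]; dsimp only; rw [mul_comm]; exact Complex.norm_exp_ofReal_mul_I _
  set F : ℝ → ℂ := fun s => -Complex.I * ((q s : ℂ) * e s) with hF
  have hFd : ∀ s : ℝ, 0 < s → HasDerivAt F (e s + -Complex.I * ((dq s : ℂ) * e s)) s := by
    intro s hs
    have := (((hqd s hs).ofReal_comp).mul (hed s hs)).const_mul (-Complex.I)
    refine this.congr_deriv ?_
    have h1 : q s * (2 * s + 2 * d / s^3) = 1 := by
      have := hpd s hs
      simp only [hq]; field_simp
    have h2 : (q s : ℂ) * ((2 * s + 2 * d / s^3 : ℝ) : ℂ) = 1 := by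
      exact_mod_cast h1
    have : (q s : ℂ) * (e s * (Complex.I * ((2 * s + 2 * d / s^3 : ℝ) : ℂ))) = Complex.I * e s := by
      linear_combination (Complex.I * e s) * h2
    rw [this]
    linear_combination (-e s) * Complex.I_mul_I
  have hec : ContinuousOn e (Set.uIcc 1 b) := fun s hs => (hed s (hpos s hs)).continuousAt.continuousWithinAt
  have hqc : ContinuousOn dq (Set.uIcc 1 b) := by
    have h1 : ∀ s ∈ Set.uIcc 1 b, (2 * (s^4 + d))^2 ≠ 0 := fun s hs => by
      have := hpd s (hpos s hs); positivity
    apply ContinuousOn.div _ _ h1 <;> fun_prop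
  have hrc : ContinuousOn (fun s => -Complex.I * ((dq s : ℂ) * e s)) (Set.uIcc 1 b) :=
    continuousOn_const.mul ((Complex.continuous_ofReal.comp_continuousOn hqc).mul hec)
  have hint := intervalIntegral.integral_eq_sub_of_hasDerivAt (fun s hs => hFd s (hpos s hs))
    ((hec.add hrc).intervalIntegrable)
  rw [intervalIntegral.integral_add hec.intervalIntegrable hrc.intervalIntegrable] at hint
  have hqb : ∀ s : ℝ, 1 ≤ s → ‖F s‖ ≤ 1/2 := by
    intro s hs
    have h0 := hpd s (by linarith)
    simp only [hF, norm_mul, norm_neg, Complex.norm_I, hen, one_mul, mul_one, Complex.norm_real]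
    rw [Real.norm_of_nonneg (by positivity)]
    simp only [hq]
    rw [div_le_div_iff₀ (by positivity) (by positivity)]
    nlinarith [pow_le_pow_right₀ hs (show 3 ≤ 4 by norm_num)]
  have hrb : ‖∫ s in (1:ℝ)..b, -Complex.I * ((dq s : ℂ) * e s)‖ ≤ ∫ s in (1:ℝ)..b, 7/2 * (s^2)⁻¹ := by
    apply intervalIntegral.norm_integral_le_of_norm_le hb
    · refine Filter.Eventually.of_forall fun s hs => ?_
      have hs0 : 0 < s := by linarith [hs.1]
      have h0 := hpd s hs0
      simp only [norm_mul, norm_neg, Complex.norm_I, hen, one_mul, mul_one, Complex.norm_real]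
      simp only [hdq, Real.norm_eq_abs]
      rw [abs_div, abs_of_pos (show 0 < (2 * (s^4 + d))^2 by positivity), ← div_eq_mul_inv,
        div_le_div_iff₀ (by positivity) (by positivity)]
      have : |3 * s ^ 2 * (2 * (s ^ 4 + d)) - s ^ 3 * (2 * (4 * s ^ 3))| ≤ 14 * s^2 * (s^4+d) := by
        rw [abs_le]; constructor <;> nlinarith [show 0 ≤ s^2 * d by positivity, show 0 ≤ s^6 by positivity]
      calc _ ≤ 14 * s^2 * (s^4+d) * s^2 := by gcongr
        _ = 14 * (s^4+d) * s^4 := by ring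
        _ ≤ 14 * (s^4+d) * (s^4+d) := by gcongr; linarith
        _ = _ := by ring
    · apply ContinuousOn.intervalIntegrable
      have : ∀ s ∈ Set.uIcc 1 b, s^2 ≠ 0 := fun s hs => by
        have := hpos s hs; positivity
      exact continuousOn_const.mul (ContinuousOn.inv₀ (by fun_prop) this)
  have hval : ∫ s in (1:ℝ)..b, 7/2 * (s^2)⁻¹ = 7/2 * (1 - b⁻¹) := by
    have : ∀ s ∈ Set.uIcc 1 b, HasDerivAt (fun s : ℝ => -(7/2) * s⁻¹) (7/2 * (s^2)⁻¹) s := by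
      intro s hs
      refine ((hasDerivAt_inv (hpos s hs).ne').const_mul (-(7/2))).congr_deriv ?_
      ring
    rw [intervalIntegral.integral_eq_sub_of_hasDerivAt this]
    · simp; ring
    · apply ContinuousOn.intervalIntegrable
      have : ∀ s ∈ Set.uIcc 1 b, s^2 ≠ 0 := fun s hs => by
        have := hpos s hs; positivity
      exact continuousOn_const.mul (ContinuousOn.inv₀ (by fun_prop) this)
  have hbi : 0 ≤ b⁻¹ := by positivity
  have heq : ∫ s in (1:ℝ)..b, e s = F b - F 1 - ∫ s in (1:ℝ)..b, -Complex.I * ((dq s : ℂ) * e s) := by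
    rw [← hint]; ring
  change ‖∫ s in (1:ℝ)..b, e s‖ ≤ 5
  rw [heq]
  have n1 := norm_sub_le (F b - F 1) (∫ s in (1:ℝ)..b, -Complex.I * ((dq s : ℂ) * e s))
  have n2 := norm_sub_le (F b) (F 1)
  linarith [hqb b hb, hqb 1 le_rfl]

lemma aux_fresnel_pos (B : ℝ) (hB : 0 ≤ B) :
    ‖∫ w in (0:ℝ)..B, Complex.exp (Complex.I * ((w^2 : ℝ) : ℂ))‖ ≤ 6 := by
  have hn : ∀ w : ℝ, ‖Complex.exp (Complex.I * ((w^2 : ℝ) : ℂ))‖ = 1 := fun w => by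
    rw [mul_comm]; exact Complex.norm_exp_ofReal_mul_I _
  have hs : ∀ B : ℝ, 0 ≤ B → B ≤ 1 → ‖∫ w in (0:ℝ)..B, Complex.exp (Complex.I * ((w^2 : ℝ) : ℂ))‖ ≤ 1 := by
    intro B h0 h1
    have := intervalIntegral.norm_integral_le_of_norm_le_const (a := 0) (b := B) (C := 1)
      (f := fun w : ℝ => Complex.exp (Complex.I * ((w^2 : ℝ) : ℂ))) (fun w _ => (hn w).le)
    rw [sub_zero, abs_of_nonneg h0] at this
    linarith
  rcases le_total B 1 with h | h
  · linarith [hs B hB h]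
  · have hc : Continuous (fun w : ℝ => Complex.exp (Complex.I * ((w^2 : ℝ) : ℂ))) := by fun_prop
    rw [← intervalIntegral.integral_add_adjacent_intervals (b := 1) (hc.intervalIntegrable _ _) (hc.intervalIntegrable _ _)]
    have h2 := aux_neg 0 le_rfl B h
    simp only [zero_div, sub_zero] at h2
    have := norm_add_le (∫ w in (0:ℝ)..1, Complex.exp (Complex.I * ((w^2 : ℝ) : ℂ))) (∫ w in (1:ℝ)..B, Complex.exp (Complex.I * ((w^2 : ℝ) : ℂ)))
    linarith [hs 1 zero_le_one le_rfl]

lemma aux_fresnel (B : ℝ) :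
    ‖∫ w in (0:ℝ)..B, Complex.exp (Complex.I * ((w^2 : ℝ) : ℂ))‖ ≤ 6 := by
  rcases le_total 0 B with h | h
  · exact aux_fresnel_pos B h
  · have := aux_fresnel_pos (-B) (by linarith)
    have h2 := intervalIntegral.integral_comp_neg (a := B) (b := 0)
      (fun w : ℝ => Complex.exp (Complex.I * ((w^2 : ℝ) : ℂ)))
    simp only [neg_sq, neg_zero] at h2
    rw [← h2] at this
    rwa [intervalIntegral.integral_symm, norm_neg]

lemma aux_pos (c : ℝ) (b : ℝ) (hb : 1 ≤ b) :
    ‖∫ s in (1:ℝ)..b, Complex.exp (Complex.I * ((s^2 + c^2 / s^2 : ℝ) : ℂ))‖ ≤ 12 := by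
  set g : ℝ → ℂ := fun w : ℝ => Complex.exp (Complex.I * ((w^2 : ℝ) : ℂ)) with hg
  have hgc : Continuous g := by fun_prop
  set E : ℝ → ℂ := fun B => ∫ w in (0:ℝ)..B, g w with hE
  have hEd : ∀ w, HasDerivAt E (g w) w := fun w => hgc.integral_hasStrictDerivAt 0 w |>.hasDerivAt
  have hpos : ∀ s ∈ Set.uIcc 1 b, 0 < s := by
    intro s hs
    rw [Set.uIcc_of_le hb] at hs
    linarith [hs.1]
  set p : ℂ := Complex.exp (Complex.I * ((2 * c : ℝ) : ℂ)) with hp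
  set m : ℂ := Complex.exp (Complex.I * ((-(2 * c) : ℝ) : ℂ)) with hm
  set G : ℝ → ℂ := fun s => 1/2 * p * E (s - c * s⁻¹) + 1/2 * m * E (s + c * s⁻¹) with hG
  have hGd : ∀ s ∈ Set.uIcc 1 b, HasDerivAt G (Complex.exp (Complex.I * ((s^2 + c^2 / s^2 : ℝ) : ℂ))) s := by
    intro s hs
    have hs0 := hpos s hs
    have hi := (hasDerivAt_inv hs0.ne').const_mul c
    have h1 := (hEd (s - c * s⁻¹)).scomp s ((hasDerivAt_id s).sub hi)
    have h2 := (hEd (s + c * s⁻¹)).scomp s ((hasDerivAt_id s).add hi)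
    have h3 := (h1.const_mul (1/2 * p)).add (h2.const_mul (1/2 * m))
    refine h3.congr_deriv ?_
    have e1 : p * g (s - c * s⁻¹) = Complex.exp (Complex.I * ((s^2 + c^2 / s^2 : ℝ) : ℂ)) := by
      rw [hp, hg]; dsimp only
      rw [← Complex.exp_add, ← mul_add, ← Complex.ofReal_add]
      congr 3
      field_simp; ring
    have e2 : m * g (s + c * s⁻¹) = Complex.exp (Complex.I * ((s^2 + c^2 / s^2 : ℝ) : ℂ)) := by
      rw [hm, hg]; dsimp only
      rw [← Complex.exp_add, ← mul_add, ← Complex.ofReal_add]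
      congr 3
      field_simp; ring
    simp only [Complex.real_smul]
    push_cast
    push_cast at e1 e2
    linear_combination ((1/2) * (1 - (c:ℂ) * -((s:ℂ)^2)⁻¹)) * e1 + (1/2 * (1 + (c:ℂ) * -((s:ℂ)^2)⁻¹)) * e2
  have hcont : ContinuousOn (fun s : ℝ => Complex.exp (Complex.I * ((s^2 + c^2 / s^2 : ℝ) : ℂ))) (Set.uIcc 1 b) := by
    have : ∀ s ∈ Set.uIcc 1 b, s^2 ≠ 0 := fun s hs => by
        have := hpos s hs; positivity
    have h2 : ContinuousOn (fun s : ℝ => s^2 + c^2 / s^2) (Set.uIcc 1 b) := by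
      apply ContinuousOn.add (by fun_prop)
      exact ContinuousOn.div (by fun_prop) (by fun_prop) this
    exact Complex.continuous_exp.comp_continuousOn (continuousOn_const.mul (Complex.continuous_ofReal.comp_continuousOn h2))
  rw [intervalIntegral.integral_eq_sub_of_hasDerivAt hGd hcont.intervalIntegrable]
  have hpn : ‖p‖ = 1 := by rw [hp, mul_comm]; exact Complex.norm_exp_ofReal_mul_I _
  have hmn : ‖m‖ = 1 := by rw [hm, mul_comm]; exact Complex.norm_exp_ofReal_mul_I _
  have hGb : ∀ s, ‖G s‖ ≤ 6 := by
    intro s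
    have := norm_add_le (1/2 * p * E (s - c * s⁻¹)) (1/2 * m * E (s + c * s⁻¹))
    simp only [norm_mul, hpn, hmn] at this
    norm_num at this
    have a1 := aux_fresnel (s - c * s⁻¹)
    have a2 := aux_fresnel (s + c * s⁻¹)
    change ‖E _‖ ≤ 6 at a1 a2
    simp only [hG]
    norm_num
    linarith
  linarith [norm_sub_le (G b) (G 1), hGb b, hGb 1]

lemma aux_all (ξ : ℝ) (b : ℝ) (hb : 1 ≤ b) :
    ‖∫ s in (1:ℝ)..b, Complex.exp (Complex.I * ((s^2 + ξ / s^2 : ℝ) : ℂ))‖ ≤ 12 := by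
  rcases le_total 0 ξ with h | h
  · have := aux_pos (Real.sqrt ξ) b hb
    rwa [Real.sq_sqrt h] at this
  · have := aux_neg (-ξ) (by linarith) b hb
    simp only [neg_div, sub_neg_eq_add] at this
    linarith

lemma aux_deriv (k : ℕ) (ν : Measure ℝ) [IsFiniteMeasure ν] (h : ℝ → ℂ) (hm : Measurable h)
    (hn : ∀ ξ, ‖h ξ‖ = 1) (hint : ∀ j ≤ k, Integrable (fun ξ : ℝ => |ξ| ^ j) ν)
    (g : ℝ → ℂ) (hg : ∀ lam : ℝ, g lam = ∫ ξ, Complex.exp (Complex.I * lam * ξ) * h ξ ∂ν) :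
    ∀ j ≤ k, iteratedDeriv j g =
      fun lam : ℝ => ∫ ξ : ℝ, (Complex.I * ξ) ^ j * (Complex.exp (Complex.I * lam * ξ) * h ξ) ∂ν := by
  have hexp : ∀ x ξ : ℝ, ‖Complex.exp (Complex.I * x * ξ)‖ = 1 := by
    intro x ξ
    have := Complex.norm_exp_I_mul_ofReal (x * ξ)
    rwa [Complex.ofReal_mul, ← mul_assoc] at this
  have hnorm : ∀ (j : ℕ) (x ξ : ℝ), ‖(Complex.I * ξ) ^ j * (Complex.exp (Complex.I * x * ξ) * h ξ)‖ = |ξ| ^ j := by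
    intro j x ξ
    simp [hexp, hn]
  have hmeas : ∀ (j : ℕ) (x : ℝ), AEStronglyMeasurable
      (fun ξ : ℝ => (Complex.I * ξ) ^ j * (Complex.exp (Complex.I * x * ξ) * h ξ)) ν := by
    intro j x
    apply Measurable.aestronglyMeasurable
    fun_prop
  intro j
  induction j with
  | zero =>
    intro _
    funext x
    simp [hg]
  | succ j ih =>
    intro hj
    rw [iteratedDeriv_succ, ih (by omega)]
    funext x
    refine HasDerivAt.deriv (hasDerivAt_integral_of_dominated_loc_of_deriv_le
      (F' := fun (x : ℝ) (ξ : ℝ) => (Complex.I * ξ) ^ (j+1) * (Complex.exp (Complex.I * x * ξ) * h ξ))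
      (bound := fun ξ => |ξ| ^ (j+1)) (s := Set.univ) Filter.univ_mem
      (Filter.Eventually.of_forall fun y => hmeas j y) ?_ (hmeas (j+1) x) ?_ (hint (j+1) hj) ?_).2
    · exact (hint j (by omega)).mono' (hmeas j x) (Filter.Eventually.of_forall fun ξ => (hnorm j x ξ).le)
    · exact Filter.Eventually.of_forall fun ξ y _ => (hnorm (j+1) y ξ).le
    · refine Filter.Eventually.of_forall fun ξ y _ => ?_
      have h1 : HasDerivAt (fun y : ℝ => Complex.I * (y:ℂ) * (ξ:ℂ)) (Complex.I * 1 * ξ) y :=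
        ((Complex.ofRealCLM.hasDerivAt (x := y)).const_mul Complex.I).mul_const (ξ:ℂ)
      refine ((h1.cexp.mul_const (h ξ)).const_mul ((Complex.I * ξ) ^ j)).congr_deriv ?_
      ring

lemma aux_integrable (k : ℕ) (ν : Measure ℝ) [IsFiniteMeasure ν]
    (hk : (∫⁻ ξ, (‖ξ‖₊ : ℝ≥0∞) ^ k ∂ν) ≠ ∞) : ∀ j ≤ k, Integrable (fun ξ : ℝ => |ξ| ^ j) ν := by
  have h1 : Integrable (fun ξ : ℝ => |ξ| ^ k) ν := by
    refine ⟨by fun_prop, ?_⟩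
    rw [HasFiniteIntegral]
    refine lt_of_eq_of_lt ?_ (lt_top_iff_ne_top.2 hk)
    refine lintegral_congr fun ξ => ?_
    rw [enorm_pow]
    simp [enorm]
  intro j hj
  refine ((integrable_const (1:ℝ)).add h1).mono' (by fun_prop) (Filter.Eventually.of_forall fun ξ => ?_)
  simp only [Pi.add_apply, norm_pow, Real.norm_eq_abs, abs_abs]
  rcases le_total |ξ| 1 with h | h
  · have := pow_le_one₀ (n := j) (abs_nonneg ξ) h
    have := pow_nonneg (abs_nonneg ξ) k
    linarith
  · have := pow_le_pow_right₀ h hj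
    linarith

lemma aux_main (k : ℕ) (f g : ℝ → ℂ) (r : ℝ) (hr : 1 < r)
    (hf : ∀ x : ℝ, 0 < x → x ≤ 1 → iteratedDeriv k f x =
      ((Real.sqrt x : ℝ) : ℂ) * Complex.exp (-(Complex.I / (x : ℂ))))
    (hg : memWiener k g) (hfg : Set.EqOn g f (Set.Icc (-r) r)) : False := by
  obtain ⟨ν, h, hν, hm, hn, hk, hrep⟩ := hg
  have hint := aux_integrable k ν hk
  have hD := aux_deriv k ν h hm hn hint g hrep k le_rfl
  set K : ℝ := ∫ ξ : ℝ, |ξ| ^ k ∂ν with hK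
  have hkey : ∀ x : ℝ, 0 < x → x ≤ 1 →
      (∫ ξ : ℝ, (Complex.I * ξ) ^ k * (Complex.exp (Complex.I * x * ξ) * h ξ) ∂ν) =
      ((Real.sqrt x : ℝ) : ℂ) * Complex.exp (-(Complex.I / (x : ℂ))) := by
    intro x h0 h1
    rw [← hf x h0 h1]
    have : g =ᶠ[nhds x] f :=
      Filter.eventuallyEq_of_mem (Icc_mem_nhds (by linarith) (by linarith)) hfg
    rw [← this.iteratedDeriv_eq k, hD]
  have hkey2 : ∀ s : ℝ, 1 ≤ s →
      (∫ ξ : ℝ, ((Complex.I * ξ) ^ k * h ξ) * Complex.exp (Complex.I * ((s^2 + ξ / s^2 : ℝ) : ℂ)) ∂ν)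
      = ((s⁻¹ : ℝ) : ℂ) := by
    intro s hs
    have hs0 : 0 < s := by linarith
    have hsc : (s : ℂ) ≠ 0 := by exact_mod_cast hs0.ne'
    have h1 := hkey ((s⁻¹)^2) (by positivity) (pow_le_one₀ (by positivity) (inv_le_one_of_one_le₀ hs))
    rw [Real.sqrt_sq (by positivity)] at h1
    have h2 := congrArg (fun z => z * Complex.exp (Complex.I * (s:ℂ)^2)) h1
    beta_reduce at h2
    rw [← integral_mul_const, mul_assoc, ← Complex.exp_add] at h2
    rw [show -(Complex.I / (((s⁻¹)^2 : ℝ) : ℂ)) + Complex.I * (s:ℂ)^2 = 0 by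
      push_cast; field_simp; ring, Complex.exp_zero, mul_one] at h2
    rw [← h2]
    refine integral_congr_ae (Filter.Eventually.of_forall fun ξ => ?_)
    beta_reduce
    rw [show Complex.I * ((s^2 + ξ / s^2 : ℝ) : ℂ) = Complex.I * (((s⁻¹)^2 : ℝ) : ℂ) * ξ + Complex.I * (s:ℂ)^2 by
      push_cast; field_simp; ring, Complex.exp_add]
    ring
  have hlog : ∀ b : ℝ, 1 ≤ b → Real.log b ≤ 12 * K := by
    intro b hb
    have hsw := intervalIntegral_integral_swap (μ := ν) (a := 1) (b := b)
      (f := fun (s ξ : ℝ) => ((Complex.I * ξ) ^ k * h ξ) * Complex.exp (Complex.I * ((s^2 + ξ / s^2 : ℝ) : ℂ))) ?_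
    · have hL : ∫ s in (1:ℝ)..b, ∫ ξ : ℝ, ((Complex.I * ξ) ^ k * h ξ) * Complex.exp (Complex.I * ((s^2 + ξ / s^2 : ℝ) : ℂ)) ∂ν
          = ((Real.log b : ℝ) : ℂ) := by
        rw [intervalIntegral.integral_congr (g := fun s : ℝ => ((s⁻¹ : ℝ) : ℂ))]
        · rw [intervalIntegral.integral_ofReal, integral_inv_of_pos one_pos (by linarith), div_one]
        · intro s hs
          rw [Set.uIcc_of_le hb] at hs
          exact hkey2 s hs.1
      rw [hL] at hsw
      have hnb : ‖((Real.log b : ℝ) : ℂ)‖ ≤ ∫ ξ : ℝ, 12 * |ξ| ^ k ∂ν := by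
        rw [hsw]
        refine norm_integral_le_of_norm_le ((hint k le_rfl).const_mul 12) (Filter.Eventually.of_forall fun ξ => ?_)
        rw [intervalIntegral.integral_const_mul, norm_mul]
        have h1 : ‖(Complex.I * (ξ:ℂ)) ^ k * h ξ‖ = |ξ| ^ k := by simp [hn]
        rw [h1, mul_comm]
        exact mul_le_mul_of_nonneg_right (aux_all ξ b hb) (by positivity)
      rw [integral_const_mul, Complex.norm_real, Real.norm_of_nonneg (Real.log_nonneg hb)] at hnb
      exact hnb
    · have hfin : IsFiniteMeasure (volume.restrict (Set.uIoc 1 b)) := by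
        rw [Set.uIoc_of_le hb]; infer_instance
      have hb1 : Integrable (fun z : ℝ × ℝ => (1:ℝ) * |z.2| ^ k) ((volume.restrict (Set.uIoc 1 b)).prod ν) :=
        Integrable.mul_prod (f := fun _ : ℝ => (1:ℝ)) (g := fun ξ : ℝ => |ξ|^k) (integrable_const _) (hint k le_rfl)
      refine hb1.mono' ?_ (Filter.Eventually.of_forall fun z => ?_)
      · apply Measurable.aestronglyMeasurable
        unfold Function.uncurry
        fun_prop
      · obtain ⟨s, ξ⟩ := z
        have := Complex.norm_exp_I_mul_ofReal (s^2 + ξ / s^2)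
        simp only [Function.uncurry_apply_pair]
        rw [norm_mul, this]
        simp [hn]
  have hK0 : 0 ≤ K := integral_nonneg fun ξ => by positivity
  have := hlog (Real.exp (12 * K + 1)) (Real.one_le_exp (by linarith))
  rw [Real.log_exp] at this
  linarith

lemma aux_eta (x y : ℝ) (hx : 0 < x) (hxy : x ≤ y) (hd : y - x ≤ 1) :
    ‖((Real.sqrt x : ℝ) : ℂ) * Complex.exp (-(Complex.I / (x : ℂ))) -
      ((Real.sqrt y : ℝ) : ℂ) * Complex.exp (-(Complex.I / (y : ℂ)))‖ ≤ 3 * (y - x) ^ ((1:ℝ)/4) := by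
  have hy : 0 < y := by linarith
  have hxc : (x : ℂ) ≠ 0 := by exact_mod_cast hx.ne'
  have hyc : (y : ℂ) ≠ 0 := by exact_mod_cast hy.ne'
  set t : ℝ := (y - x) / (x * y) with ht
  have ht0 : 0 ≤ t := by apply div_nonneg <;> nlinarith
  have hd0 : 0 ≤ y - x := by linarith
  have hyn : ‖Complex.exp (-(Complex.I / (y : ℂ)))‖ = 1 := by
    have := Complex.norm_exp_I_mul_ofReal (-(1/y))
    rw [← this]; congr 2; push_cast; ring
  have hE : Complex.exp (-(Complex.I / (x : ℂ))) = Complex.exp (-(Complex.I / (y : ℂ))) *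
      Complex.exp (Complex.I * ((-t : ℝ) : ℂ)) := by
    rw [← Complex.exp_add]; congr 1
    rw [ht]; push_cast; field_simp; ring
  have hb : ‖Complex.exp (Complex.I * ((-t : ℝ) : ℂ)) - 1‖ ≤ 2 * t ^ ((1:ℝ)/4) := by
    rcases le_total t 1 with h | h
    · have h1 := Real.norm_exp_I_mul_ofReal_sub_one_le (x := -t)
      rw [norm_neg, Real.norm_of_nonneg ht0] at h1
      have h2 : t ^ (1:ℝ) ≤ t ^ ((1:ℝ)/4) := by
        rcases ht0.eq_or_lt with h0 | h0
        · rw [← h0]; norm_num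
        · exact Real.rpow_le_rpow_of_exponent_ge h0 h (by norm_num)
      rw [Real.rpow_one] at h2
      linarith
    · have h1 := norm_sub_le (Complex.exp (Complex.I * ((-t : ℝ) : ℂ))) 1
      rw [Complex.norm_exp_I_mul_ofReal, norm_one] at h1
      have h2 := Real.one_le_rpow h (show (0:ℝ) ≤ 1/4 by norm_num)
      linarith
  have hst : Real.sqrt x * t ^ ((1:ℝ)/4) ≤ (y - x) ^ ((1:ℝ)/4) := by
    have : Real.sqrt x = (x^2) ^ ((1:ℝ)/4) := by
      rw [Real.sqrt_eq_rpow, ← Real.rpow_natCast, ← Real.rpow_mul hx.le]; norm_num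
    rw [this, ← Real.mul_rpow (by positivity) ht0]
    apply Real.rpow_le_rpow (by positivity) _ (by norm_num)
    rw [ht, mul_div_assoc', div_le_iff₀ (by positivity)]
    nlinarith [mul_nonneg (mul_nonneg hd0 hx.le) hd0]
  have hsq : Real.sqrt y - Real.sqrt x ≤ (y - x) ^ ((1:ℝ)/4) := by
    have h1 : Real.sqrt y ≤ Real.sqrt (y - x) + Real.sqrt x := by
      have := Real.sqrt_le_sqrt (show y ≤ (Real.sqrt (y-x) + Real.sqrt x)^2 by
        nlinarith [Real.sq_sqrt hd0, Real.sq_sqrt hx.le, mul_nonneg (Real.sqrt_nonneg (y-x)) (Real.sqrt_nonneg x)])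
      rwa [Real.sqrt_sq (by positivity)] at this
    have h2 : Real.sqrt (y - x) ≤ (y-x) ^ ((1:ℝ)/4) := by
      rw [Real.sqrt_eq_rpow]
      rcases hd0.eq_or_lt with h0 | h0
      · rw [← h0]; norm_num
      · exact Real.rpow_le_rpow_of_exponent_ge h0 hd (by norm_num)
    linarith
  have hsq0 : 0 ≤ Real.sqrt y - Real.sqrt x := sub_nonneg.2 (Real.sqrt_le_sqrt hxy)
  rw [hE]
  have heq : ((Real.sqrt x : ℝ) : ℂ) * (Complex.exp (-(Complex.I / (y : ℂ))) * Complex.exp (Complex.I * ((-t : ℝ) : ℂ))) -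
      ((Real.sqrt y : ℝ) : ℂ) * Complex.exp (-(Complex.I / (y : ℂ))) =
      Complex.exp (-(Complex.I / (y : ℂ))) * (((Real.sqrt x : ℝ) : ℂ) * (Complex.exp (Complex.I * ((-t : ℝ) : ℂ)) - 1)
        - ((Real.sqrt y - Real.sqrt x : ℝ) : ℂ)) := by
    push_cast; ring
  rw [heq, norm_mul, hyn, one_mul]
  have hns := norm_sub_le (((Real.sqrt x : ℝ) : ℂ) * (Complex.exp (Complex.I * ((-t : ℝ) : ℂ)) - 1)) ((Real.sqrt y - Real.sqrt x : ℝ) : ℂ)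
  rw [norm_mul, Complex.norm_real, Complex.norm_real, Real.norm_of_nonneg hsq0, Real.norm_of_nonneg (Real.sqrt_nonneg x)] at hns
  have := mul_le_mul_of_nonneg_left hb (Real.sqrt_nonneg x)
  linarith

lemma aux_holder (ψ : ℝ → ℝ) (hψ : ContDiff ℝ (⊤ : ℕ∞) ψ)
    (hψc : HasCompactSupport ψ) (hψs : tsupport ψ ⊆ Set.Icc (-2 : ℝ) 2)
    (κ : ℝ → ℂ)
    (hκ : ∀ x : ℝ, κ x =
      if 0 < x then (↑(ψ x * Real.sqrt x) : ℂ) * Complex.exp (-(Complex.I / (x : ℂ))) else 0) :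
    ∃ C : ℝ, ∀ x y : ℝ, ‖κ x - κ y‖ ≤ C * |x - y| ^ ((1 : ℝ) / 4) := by
  obtain ⟨L, hL⟩ := ContDiff.lipschitzWith_of_hasCompactSupport (𝕂 := ℝ) hψc hψ (by simp)
  obtain ⟨P, hP⟩ := hψc.exists_bound_of_continuous hψ.continuous
  have hP0 : 0 ≤ P := (norm_nonneg _).trans (hP 0)
  have hz : ∀ x, 2 < x → ψ x = 0 := by
    intro x hx
    by_contra hne
    have := hψs (subset_tsupport ψ hne)
    linarith [this.2]
  have hen : ∀ x : ℝ, ‖Complex.exp (-(Complex.I / (x : ℂ)))‖ = 1 := by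
    intro y
    have := Complex.norm_exp_I_mul_ofReal (-(1/y))
    rw [← this]; congr 2; push_cast; ring
  have hs2 : ∀ x : ℝ, x ≤ 3 → Real.sqrt x ≤ 2 := fun x hx => by
    rw [Real.sqrt_le_left (by norm_num)]; linarith
  have hκb : ∀ x, ‖κ x‖ ≤ 2 * P := by
    intro x
    rw [hκ]
    split_ifs with h
    · rw [norm_mul, hen, mul_one, Complex.norm_real, norm_mul, Real.norm_of_nonneg (Real.sqrt_nonneg x)]
      rcases le_or_gt x 2 with h2 | h2
      · have := hs2 x (by linarith)
        nlinarith [hP x, norm_nonneg (ψ x), Real.sqrt_nonneg x]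
      · rw [hz x h2]; simp [hP0]
    · simp [hP0]
  have hL0 : (0:ℝ) ≤ L := L.2
  have main : ∀ x y : ℝ, x ≤ y → ‖κ x - κ y‖ ≤ (4 * P + 2 * L) * (y - x) ^ ((1:ℝ)/4) := by
    intro x y hxy
    have hd0 : 0 ≤ y - x := by linarith
    rcases le_total 1 (y - x) with h1 | h1
    · have h2 := Real.one_le_rpow h1 (show (0:ℝ) ≤ 1/4 by norm_num)
      have := norm_sub_le (κ x) (κ y)
      have h3 : (4 * P + 2 * L) * 1 ≤ (4 * P + 2 * L) * (y - x) ^ ((1:ℝ)/4) := by gcongr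
      linarith [hκb x, hκb y]
    · have hlin : y - x ≤ (y-x) ^ ((1:ℝ)/4) := by
        rcases hd0.eq_or_lt with h0 | h0
        · rw [← h0]; norm_num
        · have := Real.rpow_le_rpow_of_exponent_ge h0 h1 (show (1:ℝ)/4 ≤ 1 by norm_num)
          rwa [Real.rpow_one] at this
      have hR : 0 ≤ (y - x) ^ ((1:ℝ)/4) := by positivity
      rcases le_or_gt y 0 with hy | hy
      · rw [hκ, hκ, if_neg (by linarith), if_neg (by linarith)]
        simp; positivity
      rcases le_or_gt x 0 with hx | hx
      · rw [hκ, hκ, if_neg (by linarith), if_pos hy, zero_sub, norm_neg, norm_mul, hen, mul_one, Complex.norm_real,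
          norm_mul, Real.norm_of_nonneg (Real.sqrt_nonneg y)]
        have hsq : Real.sqrt y ≤ (y - x) ^ ((1:ℝ)/4) := by
          calc Real.sqrt y ≤ Real.sqrt (y - x) := Real.sqrt_le_sqrt (by linarith)
            _ ≤ _ := by
              rw [Real.sqrt_eq_rpow]
              exact Real.rpow_le_rpow_of_exponent_ge (by linarith) h1 (by norm_num)
        calc ‖ψ y‖ * Real.sqrt y ≤ P * (y - x) ^ ((1:ℝ)/4) := by gcongr; exact hP y
          _ ≤ _ := by gcongr; linarith
      rcases le_or_gt x 2 with hx2 | hx2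
      · have he := aux_eta x y hx hxy h1
        rw [hκ, hκ, if_pos hx, if_pos hy]
        have heq : (↑(ψ x * Real.sqrt x) : ℂ) * Complex.exp (-(Complex.I / (x : ℂ))) -
            (↑(ψ y * Real.sqrt y) : ℂ) * Complex.exp (-(Complex.I / (y : ℂ))) =
            (ψ x : ℂ) * (((Real.sqrt x : ℝ) : ℂ) * Complex.exp (-(Complex.I / (x : ℂ))) -
              ((Real.sqrt y : ℝ) : ℂ) * Complex.exp (-(Complex.I / (y : ℂ)))) +
            ((ψ x - ψ y : ℝ) : ℂ) * (((Real.sqrt y : ℝ) : ℂ) * Complex.exp (-(Complex.I / (y : ℂ)))) := by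
          push_cast; ring
        rw [heq]
        refine (norm_add_le _ _).trans ?_
        rw [norm_mul, norm_mul, norm_mul _ (Complex.exp (-(Complex.I / (y : ℂ)))), hen, mul_one, Complex.norm_real,
          Complex.norm_real, Complex.norm_real, Real.norm_of_nonneg (Real.sqrt_nonneg y)]
        have hl : ‖ψ x - ψ y‖ ≤ L * (y - x) := by
          have := hL.dist_le_mul x y
          rwa [dist_eq_norm, Real.dist_eq, abs_sub_comm, abs_of_nonneg hd0] at this
        calc _ ≤ P * (3 * (y - x) ^ ((1:ℝ)/4)) + (L * (y - x) ^ ((1:ℝ)/4)) * 2 := by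
              gcongr
              · exact hP x
              · exact hl.trans (by gcongr)
              · exact hs2 y (by linarith)
          _ ≤ _ := by nlinarith [mul_nonneg hP0 hR]
      · rw [hκ, hκ, if_pos hx, if_pos hy, hz x hx2, hz y (by linarith)]
        simp; positivity
  refine ⟨4 * P + 2 * L, fun x y => ?_⟩
  rcases le_total x y with h | h
  · rw [abs_sub_comm, abs_of_nonneg (by linarith)]; exact main x y h
  · rw [norm_sub_rev, abs_of_nonneg (by linarith)]; exact main y x h

/-- Theorem 4.1: let `κ(x) = 1_{(0,∞)}(x) ψ(x) √x e^{-i/x}` with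
`ψ ∈ C_c^∞(ℝ)`, `ψ ≡ 1` on `[-1,1]`, `supp ψ ⊆ [-2,2]`.  If `f ∈ C^k(ℝ)` with `f^{(k)} = κ`,
then `f^{(k)}` is `(1/4)`-Hölder continuous on `ℝ`, but `f ∉ W_k(ℝ)_loc`; in particular
`C_loc^{k,1/4}(ℝ)` contains a function not in `W_k(ℝ)_loc` (so `W_k(ℝ)_loc` is a proper
subset of `C_loc^{k,1/4}(ℝ)`). -/
theorem stmt_3 (k : ℕ) (hk : 1 ≤ k) (ψ : ℝ → ℝ) (hψ : ContDiff ℝ (⊤ : ℕ∞) ψ)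
    (hψc : HasCompactSupport ψ) (hψ1 : ∀ x ∈ Set.Icc (-1 : ℝ) 1, ψ x = 1)
    (hψs : tsupport ψ ⊆ Set.Icc (-2 : ℝ) 2)
    (κ : ℝ → ℂ)
    (hκ : ∀ x : ℝ, κ x =
      if 0 < x then (↑(ψ x * Real.sqrt x) : ℂ) * Complex.exp (-(Complex.I / (x : ℂ))) else 0)
    (f : ℝ → ℂ) (hf : ContDiff ℝ (k : ℕ∞) f) (hfk : iteratedDeriv k f = κ) :
    (∃ C : ℝ, ∀ x y : ℝ, ‖κ x - κ y‖ ≤ C * |x - y| ^ ((1 : ℝ) / 4)) ∧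
      (¬ ∀ r : ℝ, 0 < r → ∃ g : ℝ → ℂ, memWiener k g ∧ Set.EqOn g f (Set.Icc (-r) r)) ∧
      ∃ h : ℝ → ℂ,
        (ContDiff ℝ (k : ℕ∞) h ∧
          ∀ r : ℝ, 0 < r → ∃ C : ℝ, ∀ x ∈ Set.Icc (-r) r, ∀ y ∈ Set.Icc (-r) r,
            ‖iteratedDeriv k h x - iteratedDeriv k h y‖ ≤ C * |x - y| ^ ((1 : ℝ) / 4)) ∧
        ¬ ∀ r : ℝ, 0 < r → ∃ g : ℝ → ℂ, memWiener k g ∧ Set.EqOn g h (Set.Icc (-r) r) := by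
  have hH := aux_holder ψ hψ hψc hψs κ hκ
  have hN : ¬ ∀ r : ℝ, 0 < r → ∃ g : ℝ → ℂ, memWiener k g ∧ Set.EqOn g f (Set.Icc (-r) r) := by
    intro hall
    obtain ⟨g, hg, hgf⟩ := hall 2 (by norm_num)
    refine aux_main k f g 2 (by norm_num) ?_ hg hgf
    intro x h0 h1
    rw [hfk, hκ, if_pos h0, hψ1 x ⟨by linarith, h1⟩, one_mul]
  refine ⟨hH, hN, f, ⟨hf, fun r _ => ?_⟩, hN⟩
  obtain ⟨C, hC⟩ := hH
  exact ⟨C, fun x _ y _ => by rw [hfk]; exact hC x y⟩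
end
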